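/- arXiv:1703.09513 — 3 statements merged into one kernel-verified Lean document; each statement's English description precedes it below -/
import Mathlib

section
/- Robustness is anti-monotonic with respect to any projection removing a set of items: let (T, I, R) be a binary dataset with finite sets T and I, let α ∈ [0,1], let Y ⊆ I, let X ⊆ I \ Y, and let Z ⊆ I be any preimage of X under the projection removing Y, i.e., Z \ Y = X. Then the robustness of X computed in the projected dataset (T, I \ Y, R) is at least the robustness of Z computed in (T, I, R): Σ_{S ⊆ T, d(t(X) ∩ S) \ Y = X} α^{|S|}(1−α)^{|T|−|S|} ≥ Σ_{S ⊆ T, d(t(Z) ∩ S) = Z} α^{|S|}(1−α)^{|T|−|S|}. -/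
/-- `d(A) = ⋂_{t ∈ A} δ(t)`, with `d(∅) = I`. -/
def dOp {τ ι : Type*} [Fintype ι] (R : τ → ι → Prop) [∀ t i, Decidable (R t i)]
    (A : Finset τ) : Finset ι :=
  Finset.univ.filter (fun i => ∀ t ∈ A, R t i)

/-- `t(X) = {t ∈ T : X ⊆ δ(t)}`. -/
def tOp {τ ι : Type*} [Fintype τ] (R : τ → ι → Prop) [∀ t i, Decidable (R t i)]
    (X : Finset ι) : Finset τ :=
  Finset.univ.filter (fun t => ∀ i ∈ X, R t i)

/-- Robustness of `Z` in `(T, I, R)`: the sum of weights `α^{|S|}(1-α)^{|T|-|S|}`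
over all subdatasets `S ⊆ T` in which `Z` is closed, i.e. `d(t(Z) ∩ S) = Z`. -/
noncomputable def rbst {τ ι : Type*} [Fintype τ] [Fintype ι] [DecidableEq τ] [DecidableEq ι]
    (R : τ → ι → Prop) [∀ t i, Decidable (R t i)] (α : ℝ) (Z : Finset ι) : ℝ :=
  ∑ S ∈ Finset.univ.filter (fun S : Finset τ => dOp R (tOp R Z ∩ S) = Z),
    α ^ S.card * (1 - α) ^ (Fintype.card τ - S.card)

/-- Robustness of `X ⊆ I \ Y` in the projected dataset `(T, I \ Y, R)`: the sum
of weights over all `S ⊆ T` with `d(t(X) ∩ S) \ Y = X`. -/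
noncomputable def rbstProj {τ ι : Type*} [Fintype τ] [Fintype ι] [DecidableEq τ] [DecidableEq ι]
    (R : τ → ι → Prop) [∀ t i, Decidable (R t i)] (α : ℝ) (Y X : Finset ι) : ℝ :=
  ∑ S ∈ Finset.univ.filter (fun S : Finset τ => dOp R (tOp R X ∩ S) \ Y = X),
    α ^ S.card * (1 - α) ^ (Fintype.card τ - S.card)

section GaloisConnection

variable {τ ι : Type*} (R : τ → ι → Prop) [∀ t i, Decidable (R t i)]

theorem dOp_anti [Fintype ι] {A B : Finset τ} (h : A ⊆ B) : dOp R B ⊆ dOp R A := by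
  intro i hi
  simp only [dOp, Finset.mem_filter, Finset.mem_univ, true_and] at hi ⊢
  exact fun t ht => hi t (h ht)

theorem tOp_anti [Fintype τ] {X Z : Finset ι} (h : X ⊆ Z) : tOp R Z ⊆ tOp R X := by
  intro t ht
  simp only [tOp, Finset.mem_filter, Finset.mem_univ, true_and] at ht ⊢
  exact fun i hi => ht i (h hi)

theorem subset_dOp_tOp [Fintype τ] [Fintype ι] (X : Finset ι) : X ⊆ dOp R (tOp R X) := by
  intro i hi
  simp only [dOp, tOp, Finset.mem_filter, Finset.mem_univ, true_and]
  exact fun t ht => ht i hi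

/-- If `Z` is closed in the subdataset `S`, then `Z \ Y` is closed in its projection. -/
theorem dOp_sdiff_eq_of_closed [Fintype τ] [Fintype ι] [DecidableEq τ] [DecidableEq ι]
    (Y : Finset ι) {Z : Finset ι} {S : Finset τ} (h : dOp R (tOp R Z ∩ S) = Z) :
    dOp R (tOp R (Z \ Y) ∩ S) \ Y = Z \ Y := by
  apply Finset.Subset.antisymm
  · refine Finset.sdiff_subset_sdiff ?_ subset_rfl
    exact (dOp_anti R (Finset.inter_subset_inter_right
      (tOp_anti R Finset.sdiff_subset))).trans h.subset
  · refine Finset.subset_sdiff.2 ⟨?_, Finset.sdiff_disjoint⟩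
    exact (subset_dOp_tOp R _).trans (dOp_anti R Finset.inter_subset_left)

end GaloisConnection

/-- Robustness is anti-monotonic w.r.t. any projection removing a set of items `Y`:
for `α ∈ [0,1]`, `X ⊆ I \ Y` and any preimage `Z` of `X` (i.e. `Z \ Y = X`), the
robustness of `X` in the projected dataset is at least the robustness of `Z`. -/
theorem rbst_projection_antimonotonic
    {τ ι : Type*} [Fintype τ] [Fintype ι] [DecidableEq τ] [DecidableEq ι]
    (R : τ → ι → Prop) [∀ t i, Decidable (R t i)]
    (α : ℝ) (hα0 : 0 ≤ α) (hα1 : α ≤ 1)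
    (Y X Z : Finset ι) (hX : X ⊆ Finset.univ \ Y) (hZ : Z \ Y = X) :
    rbstProj R α Y X ≥ rbst R α Z := by
  subst hZ
  refine Finset.sum_le_sum_of_subset_of_nonneg ?_ fun S _ _ =>
    mul_nonneg (pow_nonneg hα0 _) (pow_nonneg (sub_nonneg.2 hα1) _)
  exact Finset.monotone_filter_right _ fun S _ hS => dOp_sdiff_eq_of_closed R Y hS
end

section
/- Lower bound on stability: let (T, I, R) be a binary dataset with finite sets T and I, and let X be a closed itemset. Then Stab(X) ≥ 1 − Σ_{Y'} 2^{−Δ(X,Y')}, where the sum ranges over all immediate closed supersets Y' of X and Δ(X,Y') = |t(X) \ t(Y')|. -/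
open scoped Classical

/-- Stability of `X` in `(T, I, R)`: `2^{-|T|}` times the number of subdatasets
`S ⊆ T` in which `X` is closed, i.e. `d(t(X) ∩ S) = X`. -/
noncomputable def stab {τ ι : Type*} [Fintype τ] [Fintype ι] [DecidableEq τ] [DecidableEq ι]
    (R : τ → ι → Prop) [∀ t i, Decidable (R t i)] (X : Finset ι) : ℝ :=
  ((Finset.univ.filter (fun S : Finset τ => dOp R (tOp R X ∩ S) = X)).card : ℝ) /
    2 ^ (Fintype.card τ)

/-- `Y'` is an immediate closed superset of `X`: `Y'` is closed, `X ⊊ Y'`, and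
there is no closed itemset strictly between them. -/
def ImmediateClosedSuperset {τ ι : Type*} [Fintype τ] [Fintype ι]
    (R : τ → ι → Prop) [∀ t i, Decidable (R t i)] (X Y' : Finset ι) : Prop :=
  dOp R (tOp R Y') = Y' ∧ X ⊂ Y' ∧ ¬ ∃ Z, dOp R (tOp R Z) = Z ∧ X ⊂ Z ∧ Z ⊂ Y'

theorem mem_dOp {τ ι : Type*} [Fintype ι] {R : τ → ι → Prop} [∀ t i, Decidable (R t i)]
    {A : Finset τ} {i : ι} : i ∈ dOp R A ↔ ∀ t ∈ A, R t i := by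
  simp [dOp]

theorem mem_tOp {τ ι : Type*} [Fintype τ] {R : τ → ι → Prop} [∀ t i, Decidable (R t i)]
    {X : Finset ι} {t : τ} : t ∈ tOp R X ↔ ∀ i ∈ X, R t i := by
  simp [tOp]

/-- The operators `d` and `t` form an antitone Galois connection. -/
theorem subset_dOp_iff_subset_tOp {τ ι : Type*} [Fintype τ] [Fintype ι]
    {R : τ → ι → Prop} [∀ t i, Decidable (R t i)] {X : Finset ι} {A : Finset τ} :
    X ⊆ dOp R A ↔ A ⊆ tOp R X := by
  simp only [Finset.subset_iff, mem_dOp, mem_tOp]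
  exact ⟨fun h t ht i hi => h hi t ht, fun h i hi t ht => h ht i hi⟩

/-- Every itemset of the form `d(A)` is closed. -/
theorem dOp_tOp_dOp {τ ι : Type*} [Fintype τ] [Fintype ι]
    (R : τ → ι → Prop) [∀ t i, Decidable (R t i)] (A : Finset τ) :
    dOp R (tOp R (dOp R A)) = dOp R A := by
  apply Finset.Subset.antisymm
  · intro i hi
    rw [mem_dOp] at hi ⊢
    exact fun t ht => hi t (subset_dOp_iff_subset_tOp.1 subset_rfl ht)
  · exact subset_dOp_iff_subset_tOp.2 subset_rfl

/-- Below every closed strict superset of `X` lies an immediate closed superset of `X`. -/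
theorem exists_immediateClosedSuperset_subset {τ ι : Type*} [Fintype τ] [Fintype ι]
    (R : τ → ι → Prop) [∀ t i, Decidable (R t i)] {X Z : Finset ι}
    (hZ : dOp R (tOp R Z) = Z) (hXZ : X ⊂ Z) :
    ∃ Y, ImmediateClosedSuperset R X Y ∧ Y ⊆ Z := by
  induction Z using Finset.strongInduction with
  | H Z ih =>
    by_cases h : ∃ W, dOp R (tOp R W) = W ∧ X ⊂ W ∧ W ⊂ Z
    · obtain ⟨W, hW, hXW, hWZ⟩ := h
      obtain ⟨Y, hY, hYW⟩ := ih W hWZ hW hXW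
      exact ⟨Y, hY, hYW.trans hWZ.subset⟩
    · exact ⟨Z, ⟨hZ, hXZ, h⟩, subset_rfl⟩

/-- If `X` is not closed in the subdataset `S`, then `S` misses `t(X) \ t(Y)` for some immediate
closed superset `Y` of `X`. -/
theorem exists_subset_compl_of_dOp_inter_ne {τ ι : Type*} [Fintype τ] [Fintype ι]
    [DecidableEq τ] (R : τ → ι → Prop) [∀ t i, Decidable (R t i)] {X : Finset ι}
    {S : Finset τ} (hS : dOp R (tOp R X ∩ S) ≠ X) :
    ∃ Y, ImmediateClosedSuperset R X Y ∧ S ⊆ (tOp R X \ tOp R Y)ᶜ := by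
  have hX : X ⊂ dOp R (tOp R X ∩ S) :=
    (subset_dOp_iff_subset_tOp.2 Finset.inter_subset_left).ssubset_of_ne hS.symm
  obtain ⟨Y, hY, hYZ⟩ := exists_immediateClosedSuperset_subset R (dOp_tOp_dOp R _) hX
  refine ⟨Y, hY, fun t ht => ?_⟩
  have hmem : t ∈ tOp R X ∩ S → t ∈ tOp R Y := fun h => subset_dOp_iff_subset_tOp.1 hYZ h
  rw [Finset.mem_inter] at hmem
  rw [Finset.mem_compl, Finset.mem_sdiff]
  tauto

theorem card_powerset_compl_div_two_pow {τ : Type*} [Fintype τ] [DecidableEq τ]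
    (B : Finset τ) :
    ((Bᶜ.powerset.card : ℕ) : ℝ) / 2 ^ Fintype.card τ = (1 / 2 : ℝ) ^ B.card := by
  rw [Finset.card_powerset, ← Finset.card_add_card_compl B, pow_add, one_div, inv_pow]
  push_cast
  field_simp

/-- Lower bound on stability: for a closed itemset `X`,
`Stab(X) ≥ 1 - Σ_{Y'} 2^{-Δ(X,Y')}`, the sum ranging over all immediate closed
supersets `Y'` of `X`, where `Δ(X,Y') = |t(X) \ t(Y')|`. -/
theorem stab_lower_bound
    {τ ι : Type*} [Fintype τ] [Fintype ι] [DecidableEq τ] [DecidableEq ι]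
    (R : τ → ι → Prop) [∀ t i, Decidable (R t i)]
    (X : Finset ι) (hX : dOp R (tOp R X) = X) :
    stab R X ≥
      1 - ∑ Y' ∈ Finset.univ.filter (fun Y' : Finset ι => ImmediateClosedSuperset R X Y'),
            (1 / 2 : ℝ) ^ ((tOp R X \ tOp R Y').card) := by
  set F := Finset.univ.filter (fun Y : Finset ι => ImmediateClosedSuperset R X Y)
  set G := Finset.univ.filter (fun S : Finset τ => dOp R (tOp R X ∩ S) = X) with hG
  have hcover : Gᶜ ⊆ F.biUnion fun Y => (tOp R X \ tOp R Y)ᶜ.powerset := by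
    intro S hS
    have hne : dOp R (tOp R X ∩ S) ≠ X := by simpa [hG] using hS
    obtain ⟨Y, hY, hSY⟩ := exists_subset_compl_of_dOp_inter_ne R hne
    exact Finset.mem_biUnion.2
      ⟨Y, Finset.mem_filter.2 ⟨Finset.mem_univ _, hY⟩, Finset.mem_powerset.2 hSY⟩
  have hcard : (2 : ℝ) ^ Fintype.card τ ≤
      G.card + ∑ Y ∈ F, ((tOp R X \ tOp R Y)ᶜ.powerset.card : ℝ) := by
    have h₁ := (Finset.card_le_card hcover).trans Finset.card_biUnion_le
    have h₂ := Finset.card_add_card_compl G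
    rw [Fintype.card_finset] at h₂
    exact_mod_cast h₂ ▸ Nat.add_le_add_left h₁ G.card
  have hpos : (0 : ℝ) < 2 ^ Fintype.card τ := by positivity
  have hstab : stab R X = G.card / 2 ^ Fintype.card τ := rfl
  simp_rw [← card_powerset_compl_div_two_pow]
  rw [hstab, ← Finset.sum_div, ge_iff_le, sub_le_iff_le_add, ← add_div, one_le_div hpos]
  exact hcard
end

section
/- Local anti-monotonicity of cosine interest: let (T, I, R) be a binary dataset with finite sets T and I, let X ⊆ I be a nonempty itemset with |t({j})| > 0 for every j ∈ X, and let i ∈ I \ X be an item with |t({i})| > 0 such that |t({i})| ≥ |t({j})| for all j ∈ X. Then Cosine(X) ≥ Cosine(X ∪ {i}). -/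
/-- Cosine interest of a nonempty itemset `X`: the support `|t(X)|` divided by
the geometric mean `(∏_{j ∈ X} |t({j})|)^{1/|X|}` of the supports of its items. -/
noncomputable def cosine {τ ι : Type*} [Fintype τ] (R : τ → ι → Prop)
    [∀ t i, Decidable (R t i)] (X : Finset ι) : ℝ :=
  ((tOp R X).card : ℝ) / (∏ j ∈ X, ((tOp R {j}).card : ℝ)) ^ ((1 : ℝ) / (X.card : ℝ))

theorem tOp_antitone {τ ι : Type*} [Fintype τ] (R : τ → ι → Prop) [∀ t i, Decidable (R t i)] :
    Antitone (tOp R) := fun _ _ hXY =>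
  Finset.monotone_filter_right _ fun _ _ h i hi => h i (hXY hi)

/-- Adjoining a factor that is at least every factor of a finite product does not decrease the
geometric mean. -/
theorem geom_mean_le_geom_mean_mul {ι : Type*} {s : Finset ι} (hs : s.Nonempty) {f : ι → ℝ}
    {a : ℝ} (hf : ∀ j ∈ s, 0 ≤ f j) (hfa : ∀ j ∈ s, f j ≤ a) :
    (∏ j ∈ s, f j) ^ ((1 : ℝ) / s.card) ≤
      ((∏ j ∈ s, f j) * a) ^ ((1 : ℝ) / (s.card + 1 : ℕ)) := by
  have hn : s.card ≠ 0 := hs.card_ne_zero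
  have ha : 0 ≤ a := hs.elim fun j hj => (hf j hj).trans (hfa j hj)
  have hP : 0 ≤ ∏ j ∈ s, f j := Finset.prod_nonneg hf
  simp only [one_div]
  set g := (∏ j ∈ s, f j) ^ ((s.card : ℝ)⁻¹)
  have hg0 : 0 ≤ g := Real.rpow_nonneg hP _
  have hgn : g ^ s.card = ∏ j ∈ s, f j := Real.rpow_inv_natCast_pow hP hn
  have hga : g ≤ a := by
    refine le_of_pow_le_pow_left₀ hn ha ?_
    rw [hgn, ← Finset.prod_const]
    exact Finset.prod_le_prod hf hfa
  calc g = (g ^ (s.card + 1)) ^ (((s.card + 1 : ℕ) : ℝ)⁻¹) :=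
        (Real.pow_rpow_inv_natCast hg0 s.card.succ_ne_zero).symm
    _ ≤ _ := by
        rw [pow_succ, hgn]
        gcongr

/-- Local anti-monotonicity of cosine interest: if `X` is a nonempty itemset
whose items all have positive support, and `i ∉ X` has positive support at
least the support of every item of `X`, then `Cosine(X) ≥ Cosine(X ∪ {i})`. -/
theorem cosine_locally_antimonotonic
    {τ ι : Type*} [Fintype τ] [Fintype ι] [DecidableEq ι]
    (R : τ → ι → Prop) [∀ t i, Decidable (R t i)]
    (X : Finset ι) (hX : X.Nonempty)
    (hpos : ∀ j ∈ X, 0 < (tOp R {j}).card)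
    (i : ι) (hi : i ∉ X) (hipos : 0 < (tOp R {i}).card)
    (hmax : ∀ j ∈ X, (tOp R {j}).card ≤ (tOp R {i}).card) :
    cosine R X ≥ cosine R (X ∪ {i}) := by
  have hprod : 0 < ∏ j ∈ X, ((tOp R {j}).card : ℝ) :=
    Finset.prod_pos fun j hj => Nat.cast_pos.mpr (hpos j hj)
  have hcard : (X ∪ {i}).card = X.card + 1 := by
    rw [Finset.card_union_of_disjoint (Finset.disjoint_singleton_right.mpr hi),
      Finset.card_singleton]
  rw [ge_iff_le, cosine, cosine, hcard,
    Finset.prod_union (Finset.disjoint_singleton_right.mpr hi), Finset.prod_singleton]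
  refine div_le_div₀ (Nat.cast_nonneg _) ?_ (Real.rpow_pos_of_pos hprod _) ?_
  · exact Nat.cast_le.mpr (Finset.card_le_card (tOp_antitone R Finset.subset_union_left))
  · exact geom_mean_le_geom_mean_mul hX (fun _ _ => Nat.cast_nonneg _)
      fun j hj => Nat.cast_le.mpr (hmax j hj)
end
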